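/- (Stopping criterion with a uniform quality constraint.) Assume 0 < γ, γ · α⁺ < 1, α⁺_k > 0 for every k ∈ K, and set λ = (γ · α⁺)/(1 − γ · α⁺). Suppose every lower-layer error is bounded by the same ε_r ≥ 0, i.e. ‖W a − W* a‖ ≤ ε_r for all a ∈ A, V* is a fixed point of B*, V^{i} = B V^{i−1} for given V^{i−1}, V^{i} : S → ℝ, and ‖V^{i} − V*‖ ≤ λ · ‖V^{i} − V^{i−1}‖. If ‖V^{i} − V^{i−1}‖ ≤ min over k ∈ K of ( (ε_r/(λ · α⁺_k)) · ( 1/γ + α⁻_k − 1 ) ), then ‖B V^{i} − V*‖ ≤ ε_r. -/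

import Mathlib

theorem Finset.abs_sup'_sub_sup'_le {ι : Type*} {s : Finset ι} (hs : s.Nonempty)
    {f g : ι → ℝ} {c : ℝ} (h : ∀ i ∈ s, |f i - g i| ≤ c) :
    |s.sup' hs f - s.sup' hs g| ≤ c := by
  have h₁ : s.sup' hs f ≤ s.sup' hs g + c := Finset.sup'_le hs _ fun i hi => by
    linarith [Finset.le_sup' g hi, (abs_le.mp (h i hi)).2]
  have h₂ : s.sup' hs g ≤ s.sup' hs f + c := Finset.sup'_le hs _ fun i hi => by
    linarith [Finset.le_sup' f hi, (abs_le.mp (h i hi)).1]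
  exact abs_le.mpr ⟨by linarith, by linarith⟩

theorem abs_sum_mul_le_of_sum_eq_one {ι : Type*} [Fintype ι] {p x : ι → ℝ} {c : ℝ}
    (hp : ∀ i, 0 ≤ p i) (hsum : ∑ i, p i = 1) (hx : ∀ i, |x i| ≤ c) :
    |∑ i, p i * x i| ≤ c :=
  calc |∑ i, p i * x i| ≤ ∑ i, |p i * x i| := Finset.abs_sum_le_sum_abs _ _
    _ ≤ ∑ i, p i * c := Finset.sum_le_sum fun i _ => by
      rw [abs_mul, abs_of_nonneg (hp i)]
      exact mul_le_mul_of_nonneg_left (hx i) (hp i)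
    _ = c := by rw [← Finset.sum_mul, hsum, one_mul]

/-- One-step error of a discounted backup whose two successor laws `p`, `q` are mixed with
weights `t` and `1 - t`. -/
theorem abs_mixture_backup_sub_le {ι : Type*} [Fintype ι] {p q v v' w w' : ι → ℝ}
    {r γ t d ε : ℝ} (hγ : 0 ≤ γ) (ht₀ : 0 ≤ t) (ht₁ : t ≤ 1)
    (hp : ∀ i, 0 ≤ p i) (hpsum : ∑ i, p i = 1) (hq : ∀ i, 0 ≤ q i) (hqsum : ∑ i, q i = 1)
    (hv : ∀ i, |v i - v' i| ≤ d) (hw : ∀ i, |w i - w' i| ≤ ε) :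
    |(r + γ * ∑ i, (t * p i * v i + (1 - t) * q i * w i)) -
      (r + γ * ∑ i, (t * p i * v' i + (1 - t) * q i * w' i))| ≤
      γ * (t * d + (1 - t) * ε) := by
  have h : (r + γ * ∑ i, (t * p i * v i + (1 - t) * q i * w i)) -
      (r + γ * ∑ i, (t * p i * v' i + (1 - t) * q i * w' i)) =
      γ * (t * ∑ i, p i * (v i - v' i) + (1 - t) * ∑ i, q i * (w i - w' i)) := by
    rw [add_sub_add_left_eq_sub, ← mul_sub, ← Finset.sum_sub_distrib,
      Finset.mul_sum _ _ t, Finset.mul_sum _ _ (1 - t), ← Finset.sum_add_distrib]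
    congr 1
    exact Finset.sum_congr rfl fun i _ => by ring
  have ht : 0 ≤ 1 - t := sub_nonneg.mpr ht₁
  rw [h, abs_mul, abs_of_nonneg hγ]
  refine mul_le_mul_of_nonneg_left ((abs_add_le _ _).trans ?_) hγ
  rw [abs_mul, abs_mul, abs_of_nonneg ht₀, abs_of_nonneg ht]
  exact add_le_add
    (mul_le_mul_of_nonneg_left (abs_sum_mul_le_of_sum_eq_one hp hpsum hv) ht₀)
    (mul_le_mul_of_nonneg_left (abs_sum_mul_le_of_sum_eq_one hq hqsum hw) ht)

theorem stmt7
    {S A : Type} [Fintype S] [Nonempty S] [Fintype A] [Nonempty A]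
    (α : S → A → ℝ) (T F : S → A → S → ℝ) (R : S → A → ℝ) (γ : ℝ)
    (W : A → S → ℝ)
    (hα : ∀ s a, 0 ≤ α s a ∧ α s a ≤ 1)
    (hT : ∀ s a s', 0 ≤ T s a s') (hTsum : ∀ s a, ∑ s', T s a s' = 1)
    (hF : ∀ s a s', 0 ≤ F s a s') (hFsum : ∀ s a, ∑ s', F s a s' = 1)
    (hγ : 0 ≤ γ ∧ γ ≤ 1)
    (B : (S → ℝ) → (S → ℝ))
    (hB : ∀ V s, B V s =
      Finset.univ.sup' Finset.univ_nonempty (fun a : A =>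
        R s a + γ * ∑ s', (α s a * T s a s' * V s' +
          (1 - α s a) * F s a s' * W a s')))
    (norm' : (S → ℝ) → ℝ)
    (hnorm : ∀ V, norm' V = Finset.univ.sup' Finset.univ_nonempty (fun s : S => |V s|))
    (aplus : ℝ)
    (haplus : aplus = Finset.univ.sup' Finset.univ_nonempty (fun p : S × A => α p.1 p.2))
    {K : Type} [Fintype K] [Nonempty K] [DecidableEq K]
    (κ : A → K) (hκ : Function.Surjective κ)
    (hKne : ∀ k : K, (Finset.univ.filter (fun p : S × A => κ p.2 = k)).Nonempty)
    (aplusk ainfk : K → ℝ)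
    (haplusk : ∀ k, aplusk k =
      (Finset.univ.filter (fun p : S × A => κ p.2 = k)).sup' (hKne k) (fun p => α p.1 p.2))
    (hainfk : ∀ k, ainfk k =
      (Finset.univ.filter (fun p : S × A => κ p.2 = k)).inf' (hKne k) (fun p => α p.1 p.2))
    (Wstar : A → S → ℝ)
    (Bstar : (S → ℝ) → (S → ℝ))
    (hBstar : ∀ V s, Bstar V s =
      Finset.univ.sup' Finset.univ_nonempty (fun a : A =>
        R s a + γ * ∑ s', (α s a * T s a s' * V s' +
          (1 - α s a) * F s a s' * Wstar a s')))
    (εr : ℝ) (hεr : 0 ≤ εr)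
    (hγpos : 0 < γ) (hlt : γ * aplus < 1)
    (hapluskpos : ∀ k : K, 0 < aplusk k)
    (lam : ℝ) (hlam : lam = γ * aplus / (1 - γ * aplus))
    (herr : ∀ a : A, norm' (fun s => W a s - Wstar a s) ≤ εr)
    (Vstar : S → ℝ) (hfix : Bstar Vstar = Vstar)
    (Viprev Vi : S → ℝ) (hstep : Vi = B Viprev)
    (hbound : norm' (fun s => Vi s - Vstar s) ≤ lam * norm' (fun s => Vi s - Viprev s))
    (hsmall : norm' (fun s => Vi s - Viprev s) ≤
      Finset.univ.inf' Finset.univ_nonempty (fun k : K =>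
        (εr / (lam * aplusk k)) * (1 / γ + ainfk k - 1)))
    : norm' (fun s => B Vi s - Vstar s) ≤ εr := by
  have norm_apply : ∀ V s, |V s| ≤ norm' V := fun V s => by
    rw [hnorm]
    exact Finset.le_sup' (fun s => |V s|) (Finset.mem_univ s)
  set e := norm' (fun s => Vi s - Vstar s)
  have he₀ : 0 ≤ e :=
    (abs_nonneg _).trans (norm_apply (fun s => Vi s - Vstar s) (Classical.arbitrary S))
  have le_aplusk : ∀ s a, α s a ≤ aplusk (κ a) := fun s a => by
    rw [haplusk]
    exact Finset.le_sup' (fun p : S × A => α p.1 p.2) (b := (s, a)) (by simp)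
  have ainfk_le : ∀ s a, ainfk (κ a) ≤ α s a := fun s a => by
    rw [hainfk]
    exact Finset.inf'_le (fun p : S × A => α p.1 p.2) (b := (s, a)) (by simp)
  have haplus_pos : 0 < aplus := by
    obtain ⟨k⟩ := ‹Nonempty K›
    refine (hapluskpos k).trans_le ?_
    rw [haplusk, haplus]
    exact Finset.sup'_mono _ (Finset.subset_univ _) _
  have hlam_pos : 0 < lam := by
    rw [hlam]
    exact div_pos (mul_pos hγpos haplus_pos) (sub_pos.mpr hlt)
  have he_le : ∀ k, γ * (aplusk k * e) ≤ εr * (1 + γ * ainfk k - γ) := fun k => by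
    have hd := hsmall.trans (Finset.inf'_le _ (Finset.mem_univ k))
    have hk := hapluskpos k
    calc γ * (aplusk k * e)
        ≤ γ * (aplusk k * (lam * ((εr / (lam * aplusk k)) * (1 / γ + ainfk k - 1)))) := by
          gcongr
          exact hbound.trans (mul_le_mul_of_nonneg_left hd hlam_pos.le)
      _ = εr * (1 + γ * ainfk k - γ) := by
          field_simp
  rw [hnorm]
  refine Finset.sup'_le _ _ fun s _ => ?_
  rw [← congrFun hfix s, hB, hBstar]
  refine Finset.abs_sup'_sub_sup'_le _ fun a _ => ?_
  refine (abs_mixture_backup_sub_le hγ.1 (hα s a).1 (hα s a).2 (hT s a) (hTsum s a)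
    (hF s a) (hFsum s a) (norm_apply fun s => Vi s - Vstar s)
    fun s' => (norm_apply (fun s => W a s - Wstar a s) s').trans (herr a)).trans ?_
  calc γ * (α s a * e + (1 - α s a) * εr)
      ≤ γ * (aplusk (κ a) * e + (1 - ainfk (κ a)) * εr) := by
        gcongr
        · exact le_aplusk s a
        · exact ainfk_le s a
    _ ≤ εr := by linarith [he_le (κ a)]
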